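/- Let N be a positive integer, let a be an integer with 1 ≤ a ≤ N, let r be a real number, and let k, n, s be integers with k ≥ n+s, n ≥ s ≥ 0 and n ≥ 2. Then for real z with 0 < z < 1, the function z ↦ X^r(k,n,s;z) − X₀^r(k,n,s;z) is differentiable and (d/dz)[X^r(k,n,s;z) − X₀^r(k,n,s;z)] = (r/z + z^{N−1}/(1−z^N))·X^r(k−1,n−1,s;z). -/

import Mathlib

/-- All groupings of an index obtained by replacing each box in
`k₁ □ k₂ □ ⋯ □ kₙ` by a comma (new block) or a plus (merge). -/
def groupings : List ℕ → List (List ℕ)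
  | [] => [[]]
  | [x] => [[x]]
  | x :: y :: rest => ((groupings (y :: rest)).map (x :: ·)) ++ groupings ((x + y) :: rest)
termination_by l => l.length

/-- The one-variable function
`L_{N,a}(k; z) = Σ_{m₁ > ⋯ > mₙ > 0, mᵢ ≡ a (mod N)} z^{m₁}/(m₁^{k₁} ⋯ mₙ^{kₙ})`. -/
noncomputable def Lv (N a : ℕ) (k : List ℕ) (z : ℝ) : ℝ :=
  ∑' m : {f : Fin k.length → ℕ // StrictAnti f ∧ ∀ i, 0 < f i ∧ f i % N = a % N},
    (if h : 0 < k.length then z ^ (m.1 ⟨0, h⟩) else 1) *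
      ∏ i : Fin k.length, ((m.1 i : ℝ) ^ k.get i)⁻¹

/-- The interpolated function `L^r_{N,a}(k; z) = Σ_p r^{n - dep(p)} L_{N,a}(p; z)`
over all groupings `p` of `k`. -/
noncomputable def iLv (N a : ℕ) (r : ℝ) (k : List ℕ) (z : ℝ) : ℝ :=
  ((groupings k).map (fun p => r ^ (k.length - p.length) * Lv N a p z)).sum

/-- An index is admissible if all entries are positive and the first entry is at least `2`. -/
def IsAdmissible (k : List ℕ) : Prop := (∀ i ∈ k, 1 ≤ i) ∧ 2 ≤ k.headI

/-- The height of an index: the number of entries that are at least `2`. -/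
def height (k : List ℕ) : ℕ := k.countP (fun i => 2 ≤ i)

/-- `X₀^r(k,n,s;z)`: sum of `L^r_{N,a}(k;z)` over all admissible indices of
weight `k`, depth `n` and height `s`. -/
noncomputable def X0z (N a : ℕ) (r : ℝ) (k n s : ℕ) (z : ℝ) : ℝ :=
  ∑' l : {l : List ℕ // IsAdmissible l ∧ l.sum = k ∧ l.length = n ∧ height l = s},
    iLv N a r l.1 z

/-- `X^r(k,n,s;z)`: sum of `L^r_{N,a}(k;z)` over all indices of
weight `k`, depth `n` and height `s`. -/
noncomputable def Xz (N a : ℕ) (r : ℝ) (k n s : ℕ) (z : ℝ) : ℝ :=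
  ∑' l : {l : List ℕ // (∀ i ∈ l, 1 ≤ i) ∧ l.sum = k ∧ l.length = n ∧ height l = s},
    iLv N a r l.1 z

/-- Adds one to the first entry of a list. -/
def incrHead : List ℕ → List ℕ
  | [] => []
  | x :: l => (x + 1) :: l

theorem groupings_succ_cons (l : List ℕ) (x : ℕ) :
    groupings ((x + 1) :: l) = (groupings (x :: l)).map incrHead := by
  induction l generalizing x with
  | nil => simp [groupings, incrHead]
  | cons y l ih =>
    have h : x + 1 + y = (x + y) + 1 := by omega
    rw [groupings, groupings, h, ih (x + y)]
    simp [incrHead, Function.comp_def]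

theorem exists_cons_of_mem_groupings (l : List ℕ) (x : ℕ) :
    ∀ p ∈ groupings (x :: l), (∃ y q, p = y :: q) ∧ p.length ≤ l.length + 1 := by
  induction l generalizing x with
  | nil => simp [groupings]
  | cons y l ih =>
    intro p hp
    rw [groupings, List.mem_append, List.mem_map] at hp
    rcases hp with ⟨q, hq, rfl⟩ | hp
    · exact ⟨⟨x, q, rfl⟩, by simpa using (ih y q hq).2⟩
    · exact ⟨(ih _ p hp).1, by have := (ih _ p hp).2; simp; omega⟩

/-- Strictly decreasing sequences of positive integers congruent to `a` modulo `N`. -/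
abbrev ResidueSeq (N a n : ℕ) : Type :=
  {f : Fin n → ℕ // StrictAnti f ∧ ∀ i, 0 < f i ∧ f i % N = a % N}

theorem summable_residueSeq (N a n : ℕ) (g : ℕ → ℝ) (hg : ∀ m, 0 ≤ g m)
    (hs : Summable fun m : ℕ => ((m : ℝ) + 1) ^ (n + 1) * g m) :
    Summable fun f : ResidueSeq N a (n + 1) => g (f.1 0) := by
  let φ : ResidueSeq N a (n + 1) → ℕ := fun f => f.1 0
  let ι : ∀ m, {f // φ f = m} → (Fin (n + 1) → Fin (m + 1)) := fun m f i =>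
    ⟨f.1.1 i, Nat.lt_succ_of_le ((f.1.2.1.antitone (Fin.zero_le i)).trans f.2.le)⟩
  have hι : ∀ m, Function.Injective (ι m) := by
    intro m f f' h
    apply Subtype.ext
    apply Subtype.ext
    funext i
    exact congrArg Fin.val (congrFun h i)
  have hfin : ∀ m, Finite {f // φ f = m} := fun m => Finite.of_injective _ (hι m)
  rw [← (Equiv.sigmaFiberEquiv φ).summable_iff]
  refine (summable_sigma_of_nonneg fun _ => hg _).2 ?_
  refine ⟨fun m => Summable.of_finite, ?_⟩
  refine Summable.of_nonneg_of_le (fun m => tsum_nonneg fun _ => hg _) (fun m => ?_) hs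
  have hval : ∀ f : {f // φ f = m},
      ((fun f : ResidueSeq N a (n + 1) => g (f.1 0)) ∘ (Equiv.sigmaFiberEquiv φ)) ⟨m, f⟩ = g m :=
    fun f => congrArg g f.2
  refine (tsum_congr hval).trans_le ?_
  rw [tsum_const, nsmul_eq_mul]
  refine mul_le_mul_of_nonneg_right ?_ (hg m)
  have := Nat.card_le_card_of_injective _ (hι m)
  rw [Nat.card_fun, Nat.card_fin, Nat.card_fin] at this
  exact_mod_cast this

theorem summable_add_one_pow_mul_geometric (n : ℕ) {ρ : ℝ} (h0 : 0 < ρ) (h1 : ρ < 1) :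
    Summable fun m : ℕ => ((m : ℝ) + 1) ^ n * ρ ^ m := by
  have h := summable_pow_mul_geometric_of_norm_lt_one (R := ℝ) n (r := ρ)
    (by rwa [Real.norm_of_nonneg h0.le])
  have h' := ((summable_nat_add_iff 1).2 h).mul_left ρ⁻¹
  refine h'.congr fun m => ?_
  push_cast
  rw [pow_succ ρ]
  field_simp

theorem prod_inv_pow_mem_Icc {N a n : ℕ} (f : ResidueSeq N a n) (k : Fin n → ℕ) :
    0 ≤ ∏ i, ((f.1 i : ℝ) ^ k i)⁻¹ ∧ ∏ i, ((f.1 i : ℝ) ^ k i)⁻¹ ≤ 1 := by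
  refine ⟨Finset.prod_nonneg fun i _ => by positivity,
    Finset.prod_le_one (fun i _ => by positivity) fun i _ => inv_le_one_of_one_le₀ ?_⟩
  exact one_le_pow₀ (by exact_mod_cast (f.2.2 i).1)

theorem prod_inv_pow_cons (x : ℕ) (q : List ℕ) (f : Fin (q.length + 1) → ℕ) :
    ∏ i : Fin (q.length + 1), ((f i : ℝ) ^ (x :: q).get i)⁻¹ =
      ((f 0 : ℝ) ^ x)⁻¹ * ∏ i : Fin q.length, ((f i.succ : ℝ) ^ q.get i)⁻¹ :=
  Fin.prod_univ_succ _

theorem Lv_cons (N a x : ℕ) (q : List ℕ) (z : ℝ) :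
    Lv N a (x :: q) z = ∑' f : ResidueSeq N a (q.length + 1),
      z ^ f.1 0 * ∏ i, ((f.1 i : ℝ) ^ (x :: q).get i)⁻¹ := by
  simp [Lv]

theorem summable_Lv_cons (N a x : ℕ) (q : List ℕ) {z : ℝ} (hz0 : 0 < z) (hz1 : z < 1) :
    Summable fun f : ResidueSeq N a (q.length + 1) =>
      z ^ f.1 0 * ∏ i, ((f.1 i : ℝ) ^ (x :: q).get i)⁻¹ := by
  refine Summable.of_nonneg_of_le (fun f => ?_) (fun f => ?_)
    (summable_residueSeq N a q.length (fun m => z ^ m) (fun m => by positivity)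
      (summable_add_one_pow_mul_geometric _ hz0 hz1))
  · exact mul_nonneg (by positivity) (prod_inv_pow_mem_Icc f _).1
  · exact mul_le_of_le_one_right (by positivity) (prod_inv_pow_mem_Icc f _).2

theorem hasDerivAt_Lv_cons (N a x : ℕ) (q : List ℕ) {z : ℝ} (hz0 : 0 < z) (hz1 : z < 1) :
    HasDerivAt (Lv N a (x :: q))
      (∑' f : ResidueSeq N a (q.length + 1),
        (f.1 0 : ℝ) * z ^ (f.1 0 - 1) * ∏ i, ((f.1 i : ℝ) ^ (x :: q).get i)⁻¹) z := by
  obtain ⟨ρ, hzρ, hρ1⟩ := exists_between hz1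
  have hρ0 : 0 < ρ := hz0.trans hzρ
  rw [show Lv N a (x :: q) = fun t => _ from funext (Lv_cons N a x q)]
  have hsum : Summable fun f : ResidueSeq N a (q.length + 1) =>
      (f.1 0 : ℝ) * ρ ^ (f.1 0 - 1) := by
    refine summable_residueSeq N a q.length (fun m => (m : ℝ) * ρ ^ (m - 1))
      (fun m => by positivity) ?_
    refine Summable.of_nonneg_of_le (fun m => by positivity) (fun m => ?_)
      ((summable_add_one_pow_mul_geometric (q.length + 2) hρ0 hρ1).mul_left ρ⁻¹)
    rcases m with _ | m
    · simp; positivity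
    · push_cast
      rw [pow_succ _ (q.length + 1), pow_succ ρ]
      have : ρ⁻¹ * (((m : ℝ) + 1 + 1) ^ (q.length + 1) * ((m : ℝ) + 1 + 1) * (ρ ^ m * ρ)) =
          ((m : ℝ) + 1 + 1) ^ (q.length + 1) * (((m : ℝ) + 1 + 1) * ρ ^ m) := by
        field_simp
      rw [this]
      gcongr
      linarith
  refine hasDerivAt_tsum_of_isPreconnected hsum (isOpen_Ioo (a := (0 : ℝ)) (b := ρ))
    isPreconnected_Ioo (fun f t _ => (hasDerivAt_pow (f.1 0) t).mul_const _) ?_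
    (y₀ := z) ⟨hz0, hzρ⟩ ?_ ⟨hz0, hzρ⟩
  · rintro f t ⟨ht0, htρ⟩
    obtain ⟨hw0, hw1⟩ := prod_inv_pow_mem_Icc f (x :: q).get
    rw [Real.norm_of_nonneg (by positivity)]
    calc _ ≤ (f.1 0 : ℝ) * t ^ (f.1 0 - 1) * 1 := by gcongr
      _ ≤ _ := by rw [mul_one]; gcongr
  · exact summable_Lv_cons N a x q hz0 hz1

theorem hasDerivAt_Lv_succ_cons (N a x : ℕ) (q : List ℕ) {z : ℝ} (hz0 : 0 < z) (hz1 : z < 1) :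
    HasDerivAt (Lv N a ((x + 1) :: q)) (1 / z * Lv N a (x :: q) z) z := by
  refine (hasDerivAt_Lv_cons N a (x + 1) q hz0 hz1).congr_deriv ?_
  rw [Lv_cons, ← tsum_mul_left]
  refine tsum_congr fun f => ?_
  refine (congrArg (_ * ·) (prod_inv_pow_cons (x + 1) q f.1)).trans ?_
  rw [prod_inv_pow_cons x q f.1]
  have hf : (f.1 0 : ℝ) ≠ 0 := by exact_mod_cast (f.2.2 0).1.ne'
  have hz : z ^ f.1 0 = z ^ (f.1 0 - 1) * z := by
    rw [← pow_succ, Nat.sub_add_cancel (f.2.2 0).1]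
  rw [hz]
  field_simp
  ring

/-- Splitting off the largest entry of a decreasing sequence in a fixed residue class,
recorded by its gap to the next entry. -/
def residueSeqConsEquiv (N a n : ℕ) (hN : 1 ≤ N) :
    ResidueSeq N a (n + 1) × ℕ ≃ ResidueSeq N a (n + 2) where
  toFun p := ⟨Fin.cons (p.1.1 0 + N * (p.2 + 1)) p.1.1, by
    constructor
    · rw [Fin.strictAnti_iff_succ_lt]
      intro i
      cases i using Fin.cases with
      | zero =>
        have : 0 < N * (p.2 + 1) := by positivity
        simpa using this
      | succ i =>
        have := p.1.2.1 (Fin.castSucc_lt_succ (i := i))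
        rw [← Fin.succ_castSucc]
        simpa using this
    · intro i
      cases i using Fin.cases with
      | zero =>
        have := p.1.2.2 0
        simp [this.2]
        omega
      | succ i => simpa using p.1.2.2 i⟩
  invFun f := (⟨Fin.tail f.1, fun i j h => f.2.1 (Fin.succ_lt_succ_iff.2 h),
    fun i => f.2.2 i.succ⟩, (f.1 0 - f.1 1) / N - 1)
  left_inv p := by
    refine Prod.ext (Subtype.ext ?_) ?_
    · simp
    · have h1 : (Fin.cons (p.1.1 0 + N * (p.2 + 1)) p.1.1 : Fin (n + 2) → ℕ) 1 = p.1.1 0 := rfl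
      simp only [Fin.cons_zero, h1, Nat.add_sub_cancel_left]
      rw [Nat.mul_div_cancel_left _ hN, Nat.add_sub_cancel]
  right_inv f := by
    apply Subtype.ext
    have hlt : f.1 1 < f.1 0 := f.2.1 (by simp)
    have hmod : N ∣ f.1 0 - f.1 1 :=
      (Nat.modEq_iff_dvd' hlt.le).1 ((f.2.2 1).2.trans (f.2.2 0).2.symm)
    obtain ⟨c, hc⟩ := hmod
    have hc0 : c ≠ 0 := by rintro rfl; omega
    have key : f.1 1 + N * ((f.1 0 - f.1 1) / N - 1 + 1) = f.1 0 := by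
      rw [hc, Nat.mul_div_cancel_left _ hN, Nat.sub_add_cancel (Nat.pos_of_ne_zero hc0), ← hc]
      omega
    funext i
    cases i using Fin.cases with
    | zero => exact key
    | succ i => rfl

theorem hasDerivAt_Lv_one_cons (N a y : ℕ) (hN : 1 ≤ N) (q : List ℕ) {z : ℝ}
    (hz0 : 0 < z) (hz1 : z < 1) :
    HasDerivAt (Lv N a (1 :: y :: q)) (z ^ (N - 1) / (1 - z ^ N) * Lv N a (y :: q) z) z := by
  refine (hasDerivAt_Lv_cons N a 1 (y :: q) hz0 hz1).congr_deriv ?_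
  have hzN0 : 0 ≤ z ^ N := by positivity
  have hzN1 : z ^ N < 1 := pow_lt_one₀ hz0.le hz1 (by omega)
  have hsum : Summable fun f : ResidueSeq N a (q.length + 1) =>
      z ^ f.1 0 * ∏ i, ((f.1 i : ℝ) ^ (y :: q).get i)⁻¹ :=
    summable_Lv_cons N a y q hz0 hz1
  have hgeo : Summable fun j : ℕ => z ^ (N - 1) * (z ^ N) ^ j :=
    (summable_geometric_of_lt_one hzN0 hzN1).mul_left _
  have hgeo' : ∑' j : ℕ, z ^ (N - 1) * (z ^ N) ^ j = z ^ (N - 1) / (1 - z ^ N) := by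
    rw [tsum_mul_left, tsum_geometric_of_lt_one hzN0 hzN1, div_eq_mul_inv]
  rw [Lv_cons, mul_comm, ← hgeo', tsum_mul_tsum_of_summable_norm hsum.norm hgeo.norm]
  refine ((residueSeqConsEquiv N a q.length hN).tsum_eq _).symm.trans (tsum_congr fun p => ?_)
  have h0 : ((residueSeqConsEquiv N a q.length hN) p).1 0 = p.1.1 0 + N * (p.2 + 1) := rfl
  have hsucc : ∀ i : Fin (q.length + 1),
      ((residueSeqConsEquiv N a q.length hN) p).1 i.succ = p.1.1 i := fun _ => rfl
  have hne : ((p.1.1 0 + N * (p.2 + 1) : ℕ) : ℝ) ≠ 0 := by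
    have := (p.1.2.2 0).1
    positivity
  have hexp : p.1.1 0 + N * (p.2 + 1) - 1 = p.1.1 0 + (N - 1) + N * p.2 := by
    rw [Nat.mul_add]; omega
  have hprod : ∏ i : Fin (q.length + 2), ((((residueSeqConsEquiv N a q.length hN) p).1 i : ℝ) ^
      (1 :: y :: q).get i)⁻¹ = ((p.1.1 0 + N * (p.2 + 1) : ℕ) : ℝ)⁻¹ *
        ∏ i : Fin (q.length + 1), ((p.1.1 i : ℝ) ^ (y :: q).get i)⁻¹ := by
    rw [Fin.prod_univ_succ]
    simp only [h0, hsucc]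
    congr 1
    exact congrArg _ (pow_one _)
  refine (congrArg (_ * ·) hprod).trans ?_
  simp only [List.length_cons]
  rw [h0, hexp, pow_add, pow_add, pow_mul]
  field_simp

theorem hasDerivAt_sum_map {α : Type*} (l : List α) (F : α → ℝ → ℝ) (G : α → ℝ) (z : ℝ)
    (h : ∀ p ∈ l, HasDerivAt (F p) (G p) z) :
    HasDerivAt (fun t => (l.map fun p => F p t).sum) (l.map G).sum z := by
  induction l with
  | nil => simpa using hasDerivAt_const z (0 : ℝ)
  | cons p l ih =>
    simp only [List.map_cons, List.sum_cons]
    exact (h p (by simp)).add (ih fun p' hp' => h p' (by simp [hp']))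

theorem iLv_one_cons (N a y : ℕ) (r : ℝ) (l : List ℕ) (t : ℝ) :
    iLv N a r (1 :: y :: l) t = ((groupings (y :: l)).map fun p =>
      r ^ ((y :: l).length - p.length) * (Lv N a (1 :: p) t + r * Lv N a (incrHead p) t)).sum := by
  have hg : groupings (1 :: y :: l) =
      (groupings (y :: l)).map (1 :: ·) ++ (groupings (y :: l)).map incrHead := by
    rw [groupings, Nat.add_comm 1 y, groupings_succ_cons]
  rw [iLv, hg, List.map_append, List.sum_append, List.map_map, List.map_map,
    ← List.sum_map_add]
  congr 1
  refine List.map_congr_left fun p hp => ?_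
  obtain ⟨⟨x, q, rfl⟩, hlen⟩ := exists_cons_of_mem_groupings l y p hp
  simp only [List.length_cons] at hlen
  have h1 : l.length + 1 + 1 - (q.length + 1) = l.length + 1 - (q.length + 1) + 1 := by omega
  have h2 : l.length + 1 + 1 - (q.length + 1 + 1) = l.length + 1 - (q.length + 1) := by omega
  simp only [Function.comp_apply, incrHead, List.length_cons, h1, h2, pow_succ]
  ring

theorem hasDerivAt_iLv_one_cons (N a y : ℕ) (hN : 1 ≤ N) (r : ℝ) (l : List ℕ) {z : ℝ}
    (hz0 : 0 < z) (hz1 : z < 1) :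
    HasDerivAt (iLv N a r (1 :: y :: l))
      ((r / z + z ^ (N - 1) / (1 - z ^ N)) * iLv N a r (y :: l) z) z := by
  rw [show iLv N a r (1 :: y :: l) = fun t => _ from funext (iLv_one_cons N a y r l), iLv,
    ← List.sum_map_mul_left]
  refine hasDerivAt_sum_map _ _ _ _ fun p hp => ?_
  obtain ⟨⟨x, q, rfl⟩, -⟩ := exists_cons_of_mem_groupings l y p hp
  refine (((hasDerivAt_Lv_one_cons N a x hN q hz0 hz1).add
    ((hasDerivAt_Lv_succ_cons N a x q hz0 hz1).const_mul r)).const_mul _).congr_deriv ?_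
  ring

/-- The indices of weight `k`, depth `n` and height `s`. -/
def indexSet (k n s : ℕ) : Set (List ℕ) :=
  {l | (∀ i ∈ l, 1 ≤ i) ∧ l.sum = k ∧ l.length = n ∧ height l = s}

/-- The admissible indices of weight `k`, depth `n` and height `s`. -/
def admissibleIndexSet (k n s : ℕ) : Set (List ℕ) :=
  {l | IsAdmissible l ∧ l.sum = k ∧ l.length = n ∧ height l = s}

theorem finite_indexSet (k n s : ℕ) : (indexSet k n s).Finite := by
  refine ((List.finite_length_eq (Fin (k + 1)) n).image (List.map Fin.val)).subset ?_
  rintro l ⟨-, hk, hn, -⟩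
  have hle : ∀ i ∈ l, i < k + 1 := fun i hi =>
    Nat.lt_succ_of_le (hk ▸ List.le_sum_of_mem hi)
  refine ⟨l.pmap (fun i hi => ⟨i, hi⟩) hle, by simpa using hn, ?_⟩
  simp [List.map_pmap]

theorem indexSet_eq_union (k n s : ℕ) (hk : 1 ≤ k) (hn : 1 ≤ n) :
    indexSet k n s =
      admissibleIndexSet k n s ∪ (List.cons 1) '' indexSet (k - 1) (n - 1) s := by
  ext l
  simp only [indexSet, admissibleIndexSet, IsAdmissible, Set.mem_union, Set.mem_image,
    Set.mem_ofPred_eq]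
  constructor
  · rintro ⟨hpos, hsum, hlen, hht⟩
    rcases l with _ | ⟨x, l⟩
    · simp at hlen; omega
    have hx := hpos x (by simp)
    rcases hx.lt_or_eq with hx | rfl
    · exact Or.inl ⟨⟨hpos, hx⟩, hsum, hlen, hht⟩
    · refine Or.inr ⟨l, ⟨fun i hi => hpos i (by simp [hi]), ?_, ?_, ?_⟩, rfl⟩
      · simp at hsum; omega
      · simp at hlen; omega
      · simpa [height] using hht
  · rintro (⟨⟨hpos, -⟩, h⟩ | ⟨l, ⟨hpos, hsum, hlen, hht⟩, rfl⟩)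
    · exact ⟨hpos, h⟩
    · refine ⟨by simpa using hpos, ?_, ?_, ?_⟩
      · simp; omega
      · simp; omega
      · simpa [height] using hht

theorem disjoint_admissibleIndexSet (k n s : ℕ) (t : Set (List ℕ)) :
    Disjoint (admissibleIndexSet k n s) (List.cons 1 '' t) := by
  rw [Set.disjoint_left]
  rintro _ ⟨⟨-, h⟩, -⟩ ⟨l, -, rfl⟩
  simp at h

theorem Xz_sub_X0z (N a : ℕ) (r : ℝ) (k n s : ℕ) (hk : 1 ≤ k) (hn : 1 ≤ n) (t : ℝ) :
    Xz N a r k n s t - X0z N a r k n s t =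
      ∑' l : indexSet (k - 1) (n - 1) s, iLv N a r (1 :: l.1) t := by
  have hfin := finite_indexSet k n s
  rw [indexSet_eq_union k n s hk hn, Set.finite_union] at hfin
  have h0 : X0z N a r k n s t = ∑' l : admissibleIndexSet k n s, iLv N a r l.1 t := rfl
  have h1 : Xz N a r k n s t = ∑' l : indexSet k n s, iLv N a r l.1 t := rfl
  have := hfin.1.to_subtype
  have := hfin.2.to_subtype
  rw [h0, h1, indexSet_eq_union k n s hk hn,
    Summable.tsum_union_disjoint (f := fun l => iLv N a r l t)
      (disjoint_admissibleIndexSet k n s _) Summable.of_finite Summable.of_finite,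
    add_sub_cancel_left, tsum_image (fun l => iLv N a r l t) (List.cons_injective.injOn)]

/-- For `k ≥ n + s`, `n ≥ s ≥ 0` and `n ≥ 2`, on `0 < z < 1` one has
`(d/dz)[X^r(k,n,s;z) - X₀^r(k,n,s;z)] = (r/z + z^{N-1}/(1-z^N)) X^r(k-1,n-1,s;z)`. -/
theorem stmt15 (N : ℕ) (hN : 1 ≤ N) (a : ℕ) (ha1 : 1 ≤ a) (ha2 : a ≤ N) (r : ℝ)
    (k n s : ℕ) (h1 : n + s ≤ k) (h2 : s ≤ n) (h3 : 2 ≤ n)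
    (z : ℝ) (hz0 : 0 < z) (hz1 : z < 1) :
    HasDerivAt (fun t => Xz N a r k n s t - X0z N a r k n s t)
      ((r / z + z ^ (N - 1) / (1 - z ^ N)) * Xz N a r (k - 1) (n - 1) s z) z := by
  have := (finite_indexSet (k - 1) (n - 1) s).to_subtype
  have := Fintype.ofFinite (indexSet (k - 1) (n - 1) s)
  simp_rw [Xz_sub_X0z N a r k n s (by omega) (by omega)]
  have hX : Xz N a r (k - 1) (n - 1) s z =
      ∑' l : indexSet (k - 1) (n - 1) s, iLv N a r l.1 z := rfl
  rw [hX, tsum_fintype, Finset.mul_sum]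
  simp_rw [tsum_fintype]
  refine HasDerivAt.fun_sum fun l _ => ?_
  obtain ⟨_ | ⟨y, l⟩, -, -, hlen, -⟩ := l
  · simp at hlen
    omega
  · exact hasDerivAt_iLv_one_cons N a y hN r l hz0 hz1
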